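/- arXiv:1210.3255 — 2 statements merged into one kernel-verified Lean document; each statement's English description precedes it below -/
import Mathlib

section
/- Let B and A be reduced commutative ℂ-algebras of finite type and let φ : B → A be a ℂ-algebra homomorphism. If ω ∈ Ω_{B/ℂ} lies in the torsion submodule of the B-module Ω_{B/ℂ}, then its image dφ(ω) ∈ Ω_{A/ℂ} lies in the torsion submodule of the A-module Ω_{A/ℂ}. (Affine form of Proposition 2.4: pull-backs of torsion differentials are torsion, p = 1.) -/
section

open Polynomial IsLocalRing nonZeroDivisors

universe u

theorem Algebra.FormallySmooth.of_charZero (K L : Type*) [Field K] [Field L] [CharZero K]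
    [Algebra K L] : Algebra.FormallySmooth K L := by
  obtain ⟨s, hs⟩ := exists_isTranscendenceBasis K L
  have := hs.isAlgebraic_field
  exact .of_algebraicIndependent_of_isSeparable hs.1

theorem KaehlerDifferential.map_injective_of_formallySmooth (F K L : Type*) [Field F] [Field K]
    [Field L] [Algebra F K] [Algebra K L] [Algebra F L] [IsScalarTower F K L]
    [Algebra.FormallySmooth K L] : Function.Injective (KaehlerDifferential.map F F K L) := by
  have hbc : Function.Injective (KaehlerDifferential.mapBaseChange F K L) := by
    rw [injective_iff_map_eq_zero]
    intro x hx
    obtain ⟨y, rfl⟩ := (Algebra.H1Cotangent.exact_δ_mapBaseChange F K L x).mp hx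
    rw [Subsingleton.elim y 0, map_zero]
  intro x y h
  have hxy : (1 : L) ⊗ₜ[K] x = (1 : L) ⊗ₜ[K] y := hbc (by simpa using h)
  exact (Module.FaithfullyFlat.tensorProduct_mk_injective (A := K) (B := L) (Ω[K⁄F])) hxy

theorem exists_derivation_quotient_maximalIdeal_pow {F R : Type*} [Field F] [CharZero F]
    [CommRing R] [IsDomain R] [IsDiscreteValuationRing R] [Algebra F R]
    (D : Derivation F (ResidueField R) (ResidueField R)) (n : ℕ) (hn : n ≠ 0) :
    ∃ Δ : Derivation F R (R ⧸ maximalIdeal R ^ n), ∀ r : R,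
      Ideal.Quotient.factor (Ideal.pow_le_self hn) (Δ r) = D (residue R r) := by
  let T := R ⧸ maximalIdeal R ^ n
  let ρ : T →ₐ[F] ResidueField R := Ideal.Quotient.factorₐ F (Ideal.pow_le_self hn)
  have hρ : Function.Surjective ρ := Ideal.Quotient.factor_surjective (Ideal.pow_le_self hn)
  have hker : ∀ x : T, ρ x = 0 → ∃ y, x = Ideal.Quotient.mk _ y ∧ y ∈ maximalIdeal R := by
    intro x hx
    obtain ⟨y, rfl⟩ := Ideal.Quotient.mk_surjective x
    exact ⟨y, rfl, (residue_eq_zero_iff y).mp hx⟩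
  have hnil : IsNilpotent (RingHom.ker (ρ : T →+* ResidueField R)) := by
    refine ⟨n, ?_⟩
    have : RingHom.ker (ρ : T →+* ResidueField R) ≤
        (maximalIdeal R).map (Ideal.Quotient.mk (maximalIdeal R ^ n)) := by
      intro x hx
      obtain ⟨y, rfl, hy⟩ := hker x hx
      exact Ideal.mem_map_of_mem _ hy
    refine le_bot_iff.mp ((Ideal.pow_right_mono this n).trans ?_)
    rw [← Ideal.map_pow, Ideal.map_quotient_self]
  have := Algebra.FormallySmooth.of_charZero F (ResidueField R)
  let σ : ResidueField R →ₐ[F] T :=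
    Algebra.FormallySmooth.liftOfSurjective (AlgHom.id F _) ρ hρ hnil
  have hσ : ∀ x, ρ (σ x) = x := fun x ↦
    Algebra.FormallySmooth.liftOfSurjective_apply (AlgHom.id F _) ρ hρ hnil x
  obtain ⟨π, hπ⟩ := IsDiscreteValuationRing.exists_irreducible R
  have hm := hπ.maximalIdeal_eq
  let t : T := Ideal.Quotient.mk _ π
  have ht : t ^ n = 0 := by
    rw [← map_pow, Ideal.Quotient.eq_zero_iff_mem, hm]
    exact Ideal.pow_mem_pow (Ideal.mem_span_singleton_self π) n
  have htd : ∀ d < n, t ^ d ≠ 0 := by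
    intro d hd h
    rw [← map_pow, Ideal.Quotient.eq_zero_iff_mem, hm, Ideal.span_singleton_pow,
      Ideal.mem_span_singleton, pow_dvd_pow_iff hπ.ne_zero hπ.not_isUnit] at h
    omega
  have hρt : ρ t = 0 := (residue_eq_zero_iff π).mpr (hm ▸ Ideal.mem_span_singleton_self π)
  let f : (ResidueField R)[X] →+* T := eval₂RingHom σ.toRingHom t
  have hfC : ∀ a, f (C a) = σ a := fun a ↦ eval₂_C _ _
  have hfX : f X = t := eval₂_X _ _
  have hρf : ∀ g, ρ (f g) = g.coeff 0 := by
    intro g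
    rw [← divX_mul_X_add g]
    simp [hfC, hfX, hρt, hσ]
  have hunit : ∀ g : (ResidueField R)[X], g.coeff 0 ≠ 0 → IsUnit (f g) := by
    intro g hg
    rw [← divX_mul_X_add g, map_add, map_mul, hfC, hfX]
    refine IsNilpotent.isUnit_add_right_of_commute ?_ ((isUnit_iff_ne_zero.mpr hg).map σ)
      (Commute.all _ _)
    exact (Commute.all _ _).isNilpotent_mul_left ⟨n, ht⟩
  have hkerf : ∀ g, f g = 0 → X ^ n ∣ g := by
    intro g hg
    by_cases h0 : g = 0
    · simp [h0]
    obtain ⟨h, hh, hX⟩ := exists_eq_pow_rootMultiplicity_mul_and_not_dvd g h0 0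
    rw [C_0, sub_zero] at hh hX
    rw [X_dvd_iff] at hX
    set d := rootMultiplicity 0 g
    rcases le_or_gt n d with hd | hd
    · exact (pow_dvd_pow X hd).trans ⟨h, hh⟩
    · rw [hh, map_mul, map_pow, hfX, (hunit h hX).mul_left_eq_zero] at hg
      exact absurd hg (htd d hd)
  have hsurj : Function.Surjective f := by
    have key : ∀ i : ℕ, ∀ r : T, ∃ g r', r = f g + t ^ i * r' := by
      intro i
      induction i with
      | zero => exact fun r ↦ ⟨0, r, by simp⟩
      | succ i ih =>
        intro r
        obtain ⟨g, r', rfl⟩ := ih r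
        obtain ⟨y, hy, hym⟩ := hker (r' - σ (ρ r')) (by simp [hσ])
        rw [hm, Ideal.mem_span_singleton] at hym
        obtain ⟨z, rfl⟩ := hym
        refine ⟨g + X ^ i * C (ρ r'), Ideal.Quotient.mk _ z, ?_⟩
        rw [map_mul] at hy
        have hy' : r' = σ (ρ r') + t * Ideal.Quotient.mk _ z := by rw [← hy]; ring
        rw [map_add, map_mul, map_pow, hfC, hfX, pow_succ]
        conv_lhs => rw [hy']
        ring
    intro r
    obtain ⟨g, r', h⟩ := key n r
    exact ⟨g, by rw [h, ht]; ring⟩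
  let E : Derivation F (ResidueField R)[X] (ResidueField R)[X] :=
    PolynomialModule.equivPolynomialSelf.compDer D.mapCoeffs
  have hE : ∀ g i, (E g).coeff i = D (g.coeff i) := fun g i ↦ rfl
  have hEker : ∀ g, f g = 0 → f (E g) = 0 := by
    intro g hg
    have h := X_pow_dvd_iff.mp (hkerf g hg)
    have : X ^ n ∣ E g := X_pow_dvd_iff.mpr fun d hd ↦ by rw [hE, h d hd, map_zero]
    obtain ⟨q, hq⟩ := this
    rw [hq, map_mul, map_pow, hfX, ht, zero_mul]
  have hEeq : ∀ g h, f g = f h → f (E g) = f (E h) := by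
    intro g h hgh
    rw [← sub_eq_zero, ← map_sub, ← map_sub]
    exact hEker _ (by rw [map_sub, hgh, sub_self])
  have hfF : ∀ (c : F) g, f (c • g) = c • f g := by
    intro c g
    rw [Algebra.smul_def, map_mul, Algebra.smul_def,
      IsScalarTower.algebraMap_apply F (ResidueField R), Polynomial.algebraMap_eq, hfC, σ.commutes]
  choose l hl using hsurj
  let mk : R → T := Ideal.Quotient.mk _
  let δ : R →ₗ[F] T :=
    { toFun := fun r ↦ f (E (l (mk r)))
      map_add' := fun x y ↦ by
        rw [← map_add, ← map_add]
        apply hEeq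
        simp only [map_add, hl, mk]
      map_smul' := fun c x ↦ by
        rw [RingHom.id_apply, ← hfF, ← E.map_smul]
        apply hEeq
        rw [hfF, hl, hl]
        rfl }
  refine ⟨Derivation.mk' δ ?_, ?_⟩
  · intro a b
    change f (E (l (mk (a * b)))) = mk a * f (E (l (mk b))) + mk b * f (E (l (mk a)))
    conv_rhs => rw [← hl (mk a), ← hl (mk b), ← map_mul, ← map_mul, ← map_add]
    rw [hEeq (l (mk (a * b))) (l (mk a) * l (mk b)) (by simp only [map_mul, hl, mk]), E.leibniz]
    simp only [smul_eq_mul, hl]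
  · intro r
    change ρ (f (E (l (mk r)))) = _
    rw [hρf, hE, ← hρf, hl]
    rfl

theorem isNoetherianRing_integralClosure_fractionRing (F C K : Type*) [Field F] [CharZero F]
    [CommRing C] [IsDomain C] [Algebra F C] [Algebra.FiniteType F C] [Field K] [Algebra C K]
    [IsFractionRing C K] : IsNoetherianRing (integralClosure C K) := by
  obtain ⟨s, g, hinj, hfin⟩ := exists_finite_inj_algHom_of_fg F C
  algebraize [g.toRingHom, (algebraMap C K).comp g.toRingHom]
  let P := MvPolynomial (Fin s) F
  have : FaithfulSMul P C := (faithfulSMul_iff_algebraMap_injective P C).mpr hinj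
  have : FaithfulSMul P K := .trans P C K
  let := FractionRing.liftAlgebra P K
  have : Module.Finite P C := hfin
  have : CharZero P := charZero_of_injective_algebraMap (MvPolynomial.C_injective (Fin s) F)
  have : CharZero (FractionRing P) :=
    charZero_of_injective_algebraMap (IsFractionRing.injective P (FractionRing P))
  have : FiniteDimensional (FractionRing P) K := by
    have : IsLocalization (Algebra.algebraMapSubmonoid C (nonZeroDivisors P)) K :=
      inferInstance
    exact Module.Finite.of_isLocalization P C (nonZeroDivisors P)
  have : IsIntegralClosure (integralClosure C K) P K := by
    have : Algebra.IsIntegral P C := inferInstance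
    refine ⟨Subtype.val_injective, fun {x} ↦ ⟨fun hx ↦ ⟨⟨x, hx.tower_top⟩, rfl⟩, ?_⟩⟩
    rintro ⟨y, rfl⟩
    exact isIntegral_trans (R := P) (A := C) _ y.2
  exact IsIntegralClosure.isNoetherianRing P (FractionRing P) K _

theorem exists_isDiscreteValuationRing_of_covBy {F : Type*} {B : Type u} [Field F] [CharZero F]
    [CommRing B] [Algebra F B] [Algebra.FiniteType F B] (p q : PrimeSpectrum B) (h : p ⋖ q) :
    ∃ (R : Type u) (_ : CommRing R) (_ : IsDomain R) (_ : IsDiscreteValuationRing R)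
      (_ : Algebra F R) (_ : Algebra B R) (_ : IsScalarTower F B R),
      RingHom.ker (algebraMap B R) = p.asIdeal ∧
      (maximalIdeal R).comap (algebraMap B R) = q.asIdeal := by
  let C := B ⧸ p.asIdeal
  let K := FractionRing C
  let S := integralClosure C K
  have : IsNoetherianRing S := isNoetherianRing_integralClosure_fractionRing F C K
  have : IsIntegrallyClosed S := integralClosure.isIntegrallyClosedOfFiniteExtension K
  have hCS : Function.Injective (algebraMap C S) := FaithfulSMul.algebraMap_injective C S
  have hkerS : RingHom.ker (algebraMap B S) = p.asIdeal := by
    rw [IsScalarTower.algebraMap_eq B C S, ← RingHom.comap_ker,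
      (RingHom.injective_iff_ker_eq_bot _).mp hCS]
    exact Ideal.mk_ker
  have : Algebra.IsIntegral B S := Algebra.IsIntegral.trans C
  obtain ⟨Q, -, hQ, hQq⟩ := Ideal.exists_ideal_over_prime_of_isIntegral q.asIdeal (⊥ : Ideal S)
    (by rw [← RingHom.ker_eq_comap_bot, hkerS]; exact h.le)
  let R := Localization.AtPrime Q
  have hmaxS : (maximalIdeal R).comap (algebraMap S R) = Q :=
    Localization.AtPrime.under_maximalIdeal
  have hker : RingHom.ker (algebraMap B R) = p.asIdeal := by
    rw [IsScalarTower.algebraMap_eq B S R, ← RingHom.comap_ker,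
      (RingHom.injective_iff_ker_eq_bot _).mp
        (IsLocalization.injective R Q.primeCompl_le_nonZeroDivisors)]
    exact hkerS
  have hmax : (maximalIdeal R).comap (algebraMap B R) = q.asIdeal := by
    rw [IsScalarTower.algebraMap_eq B S R, ← Ideal.comap_comap, hmaxS, hQq]
  have hfield : ¬ IsField R := by
    intro hR
    rw [isField_iff_maximalIdeal_eq.mp hR, ← RingHom.ker_eq_comap_bot, hker] at hmax
    exact h.lt.ne (PrimeSpectrum.ext hmax)
  have : IsIntegrallyClosed R :=
    isIntegrallyClosed_of_isLocalization R Q.primeCompl Q.primeCompl_le_nonZeroDivisors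
  have hdim : ∀ P : Ideal R, P ≠ ⊥ → P.IsPrime → P = maximalIdeal R := by
    intro P hP hP'
    by_contra hne
    have hlt : P < maximalIdeal R := lt_of_le_of_ne (le_maximalIdeal hP'.ne_top) hne
    have h1 : P.comap (algebraMap S R) < Q := by
      refine lt_of_lt_of_eq ?_ hmaxS
      exact (IsLocalization.orderEmbedding Q.primeCompl R).strictMono hlt
    have h2 : ⊥ < P.comap (algebraMap S R) := by
      rw [bot_lt_iff_ne_bot]
      intro h0
      apply hP
      rw [← IsLocalization.map_under Q.primeCompl R P, Ideal.under_def, h0, Ideal.map_bot]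
    have h1' := Ideal.IsIntegral.comap_lt_comap (R := B) h1
    have h2' := Ideal.IsIntegral.comap_lt_comap (R := B) h2
    rw [← RingHom.ker_eq_comap_bot, hkerS] at h2'
    rw [hQq] at h1'
    have hcomap : ((P.comap (algebraMap S R)).comap (algebraMap B S)).IsPrime :=
      Ideal.IsPrime.comap _
    exact h.2 (c := ⟨_, hcomap⟩) h2' h1'
  have htfae : IsDiscreteValuationRing R ↔
      IsIntegrallyClosed R ∧ ∃! P : Ideal R, P ≠ ⊥ ∧ P.IsPrime :=
    (IsDiscreteValuationRing.TFAE R hfield).out 0 3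
  have : IsDiscreteValuationRing R := htfae.mpr ⟨inferInstance, maximalIdeal R,
    ⟨fun h ↦ hfield (isField_iff_maximalIdeal_eq.mpr h), Ideal.IsMaximal.isPrime' _⟩,
    fun P hP ↦ hdim P hP.1 hP.2⟩
  exact ⟨R, inferInstance, inferInstance, this, inferInstance, inferInstance, inferInstance,
    hker, hmax⟩

theorem KaehlerDifferential.map_map_apply (F A B C : Type*) [CommRing F] [CommRing A] [CommRing B]
    [CommRing C] [Algebra F A] [Algebra F B] [Algebra F C] [Algebra A B] [Algebra A C] [Algebra B C]
    [IsScalarTower F A B] [IsScalarTower F A C] [IsScalarTower F B C] [IsScalarTower A B C]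
    (x : Ω[A⁄F]) : map F F B C (map F F A B x) = map F F A C x := by
  have h : (map F F B C).restrictScalars A ∘ₗ map F F A B = map F F A C := by
    apply LinearMap.ext_on_range (span_range_derivation F A)
    intro a
    simp [← IsScalarTower.algebraMap_apply]
  exact LinearMap.congr_fun h x

theorem KaehlerDifferential.map_residueField_eq_zero {F R : Type*} [Field F] [CharZero F]
    [CommRing R] [IsDomain R] [IsDiscreteValuationRing R] [Algebra F R] {s : R} (hs : s ≠ 0)
    {η : Ω[R⁄F]} (hη : s • η = 0) : map F F R (ResidueField R) η = 0 := by
  rw [← Module.forall_dual_apply_eq_zero_iff (ResidueField R)]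
  intro φ
  obtain ⟨n, hsn⟩ : ∃ n, s ∉ maximalIdeal R ^ n := by
    by_contra! h
    have hbot := Ideal.iInf_pow_eq_bot_of_isLocalRing _ (maximalIdeal.isMaximal R).ne_top
    exact hs ((Ideal.mem_bot).mp (hbot ▸ (Submodule.mem_iInf _).mpr h))
  have hn : n ≠ 0 := by rintro rfl; simp at hsn
  let D : Derivation F (ResidueField R) (ResidueField R) := φ.compDer (KaehlerDifferential.D F _)
  obtain ⟨Δ, hΔ⟩ := exists_derivation_quotient_maximalIdeal_pow D n hn
  have hcomp : ∀ x : Ω[R⁄F], Ideal.Quotient.factor (Ideal.pow_le_self hn)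
      (Δ.liftKaehlerDifferential x) = φ (map F F R (ResidueField R) x) := by
    intro x
    have h : (Ideal.Quotient.factorₐ R (Ideal.pow_le_self hn)).toLinearMap ∘ₗ
        Δ.liftKaehlerDifferential =
        φ.restrictScalars R ∘ₗ map F F R (ResidueField R) := by
      apply LinearMap.ext_on_range (span_range_derivation F R)
      intro a
      change Ideal.Quotient.factor (Ideal.pow_le_self hn)
        (Δ.liftKaehlerDifferential (KaehlerDifferential.D F R a)) = φ (map F F R _ _)
      rw [Derivation.liftKaehlerDifferential_comp_D, map_D]
      exact hΔ a
    exact LinearMap.congr_fun h x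
  rw [← hcomp]
  obtain ⟨r, hr⟩ := Ideal.Quotient.mk_surjective (Δ.liftKaehlerDifferential η)
  have hsr : s * r ∈ maximalIdeal R ^ n := by
    rw [← Ideal.Quotient.eq_zero_iff_mem, map_mul, hr]
    change s • Δ.liftKaehlerDifferential η = 0
    rw [← map_smul, hη, map_zero]
  have hrm : r ∈ maximalIdeal R := by
    by_contra hu
    rw [mem_maximalIdeal, mem_nonunits_iff, not_not] at hu
    exact hsn ((Ideal.mul_unit_mem_iff_mem _ hu).mp hsr)
  rw [← hr, Ideal.Quotient.factor_mk]
  exact Ideal.Quotient.eq_zero_iff_mem.mpr hrm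

theorem KaehlerDifferential.map_residueField_eq_zero_iff {F B L : Type*} [Field F] [CharZero F]
    [CommRing B] [Algebra F B] [Field L] [Algebra F L] [Algebra B L] [IsScalarTower F B L]
    (p : Ideal B) [p.IsPrime] (hp : RingHom.ker (algebraMap B L) = p) (ω : Ω[B⁄F]) :
    map F F B p.ResidueField ω = 0 ↔ map F F B L ω = 0 := by
  have hunit : p.primeCompl ≤ (IsUnit.submonoid L).comap (algebraMap B L) := fun x hx ↦
    isUnit_iff_ne_zero.mpr fun h0 ↦ hx (hp ▸ h0)
  let g : p.ResidueField →ₐ[B] L := Ideal.ResidueField.liftₐ p (Algebra.ofId B L) hp.ge hunit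
  let := g.toRingHom.toAlgebra
  have : IsScalarTower B p.ResidueField L := .of_algebraMap_eq fun x ↦ (g.commutes x).symm
  have : IsScalarTower F p.ResidueField L := .to₁₃₄ F B _ _
  have : CharZero p.ResidueField :=
    charZero_of_injective_algebraMap (algebraMap F p.ResidueField).injective
  have := Algebra.FormallySmooth.of_charZero p.ResidueField L
  rw [← map_map_apply F B p.ResidueField L,
    map_eq_zero_iff _ (map_injective_of_formallySmooth F p.ResidueField L)]

theorem KaehlerDifferential.map_residueField_eq_zero_of_covBy {F B : Type*} [Field F] [CharZero F]
    [CommRing B] [Algebra F B] [Algebra.FiniteType F B] {p q : PrimeSpectrum B} (h : p ⋖ q)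
    {ω : Ω[B⁄F]} (hω : map F F B p.asIdeal.ResidueField ω = 0) :
    map F F B q.asIdeal.ResidueField ω = 0 := by
  obtain ⟨R, _, _, _, _, _, _, hp, hq⟩ := exists_isDiscreteValuationRing_of_covBy (F := F) p q h
  have hker : RingHom.ker (algebraMap B (FractionRing R)) = p.asIdeal := by
    rw [IsScalarTower.algebraMap_eq B R (FractionRing R), ← RingHom.comap_ker,
      (RingHom.injective_iff_ker_eq_bot _).mp (IsFractionRing.injective R (FractionRing R))]
    exact hp
  have hker' : RingHom.ker (algebraMap B (ResidueField R)) = q.asIdeal := by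
    rw [IsScalarTower.algebraMap_eq B R (ResidueField R), ← RingHom.comap_ker, ← hq]
    exact congrArg _ ker_residue
  rw [map_residueField_eq_zero_iff p.asIdeal hker, ← map_map_apply F B R,
    IsLocalizedModule.eq_zero_iff R⁰] at hω
  obtain ⟨s, hs⟩ := hω
  rw [map_residueField_eq_zero_iff q.asIdeal hker', ← map_map_apply F B R]
  exact map_residueField_eq_zero (nonZeroDivisors.ne_zero s.2) hs

theorem PrimeSpectrum.wellFoundedLT_of_isNoetherianRing (B : Type*) [CommRing B]
    [IsNoetherianRing B] : WellFoundedLT (PrimeSpectrum B) :=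
  ⟨Subrelation.wf (r := InvImage (· < ·) fun p : PrimeSpectrum B ↦ p.asIdeal.height)
    (fun {_ _} h ↦ Ideal.height_strict_mono_of_isPrime h) (InvImage.wf _ wellFounded_lt)⟩

theorem PrimeSpectrum.wellFoundedGT_of_isNoetherianRing (B : Type*) [CommRing B]
    [IsNoetherianRing B] : WellFoundedGT (PrimeSpectrum B) :=
  ⟨Subrelation.wf (r := InvImage (· > ·) fun p : PrimeSpectrum B ↦ p.asIdeal)
    (fun {_ _} h ↦ h) (InvImage.wf _ wellFounded_gt)⟩

theorem KaehlerDifferential.map_residueField_eq_zero_of_mem_torsion {F B : Type*} [Field F]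
    [CharZero F] [CommRing B] [Algebra F B] [Algebra.FiniteType F B] {ω : Ω[B⁄F]}
    (hω : ω ∈ Submodule.torsion B (Ω[B⁄F])) (p : PrimeSpectrum B) :
    map F F B p.asIdeal.ResidueField ω = 0 := by
  have : IsNoetherianRing B := Algebra.FiniteType.isNoetherianRing F B
  have := PrimeSpectrum.wellFoundedLT_of_isNoetherianRing B
  have := PrimeSpectrum.wellFoundedGT_of_isNoetherianRing B
  induction p using WellFoundedLT.induction with
  | ind p ih =>
  by_cases hp : IsMin p
  · obtain ⟨s, hs⟩ := hω
    have hsp : (s : B) ∉ p.asIdeal := fun h ↦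
      notMem_nonZeroDivisors_of_mem_mem_minimalPrimes h
        (PrimeSpectrum.isMin_iff.mp hp) s.2
    have h : algebraMap B p.asIdeal.ResidueField s • map F F B p.asIdeal.ResidueField ω = 0 := by
      rw [algebraMap_smul, ← map_smul]
      exact (congrArg _ hs).trans (map_zero _)
    exact (smul_eq_zero.mp h).resolve_left
      (mt Ideal.algebraMap_residueField_eq_zero.mp hsp)
  · obtain ⟨q, hq⟩ := exists_covBy_of_wellFoundedGT hp
    exact map_residueField_eq_zero_of_covBy hq (ih q hq.lt)

theorem Ideal.isLocalization_residueField_of_mem_minimalPrimes {A : Type*} [CommRing A]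
    [IsReduced A] (q : Ideal A) [q.IsPrime] (hq : q ∈ minimalPrimes A) :
    IsLocalization q.primeCompl q.ResidueField := by
  have hinj : Function.Injective (algebraMap (Localization.AtPrime q) q.ResidueField) := by
    rw [injective_iff_map_eq_zero]
    intro x hx
    have hx' : x ∈ maximalIdeal (Localization.AtPrime q) := (residue_eq_zero_iff x).mp hx
    have := IsLocalization.subsingleton_primeSpectrum_of_mem_minimalPrimes q hq
      (Localization.AtPrime q)
    have hnil : IsNilpotent x := nilpotent_iff_mem_prime.mpr fun J hJ ↦ by
      rwa [show J = maximalIdeal (Localization.AtPrime q) from congrArg PrimeSpectrum.asIdeal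
        (Subsingleton.elim (⟨J, hJ⟩ : PrimeSpectrum _) (closedPoint _))]
    have : IsReduced (Localization.AtPrime q) :=
      isReduced_localizationPreserves q.primeCompl (Localization.AtPrime q) ‹_›
    exact hnil.eq_zero
  exact IsLocalization.isLocalization_of_algEquiv q.primeCompl
    (AlgEquiv.ofBijective (IsScalarTower.toAlgHom A (Localization.AtPrime q) q.ResidueField)
      ⟨hinj, residue_surjective⟩)

theorem KaehlerDifferential.mem_torsion_of_map_residueField_eq_zero {F A : Type*} [CommRing F]
    [CommRing A] [Algebra F A] [IsReduced A] [IsNoetherianRing A] {η : Ω[A⁄F]}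
    (hη : ∀ q : PrimeSpectrum A, map F F A q.asIdeal.ResidueField η = 0) :
    η ∈ Submodule.torsion A (Ω[A⁄F]) := by
  have hfin := minimalPrimes.finite_of_isNoetherianRing A
  let I := LinearMap.ker (LinearMap.toSpanSingleton A (Ω[A⁄F]) η)
  have hI : ¬ ((I : Set A) ⊆ ⋃ q ∈ minimalPrimes A, (q : Set A)) := by
    rw [Ideal.subset_union_prime_finite hfin ⊥ ⊥ (fun q hq _ _ ↦ hq.1.1)]
    rintro ⟨q, hq, hle⟩
    have hprime : q.IsPrime := hq.1.1
    have := q.isLocalization_residueField_of_mem_minimalPrimes hq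
    have h0 := hη ⟨q, hprime⟩
    rw [IsLocalizedModule.eq_zero_iff q.primeCompl] at h0
    obtain ⟨s, hs⟩ := h0
    exact s.2 (hle hs)
  obtain ⟨s, hsI, hs⟩ := Set.not_subset.mp hI
  refine ⟨⟨s, mem_nonZeroDivisors_iff_left.mpr fun x hx ↦ ?_⟩, hsI⟩
  by_contra hx0
  refine hs ((Ideal.iUnion_minimalPrimes (I := (⊥ : Ideal A))).ge ⟨x, ?_, ?_⟩)
  · rwa [← Ideal.zero_eq_bot, ← nilradical, nilradical_eq_zero, Ideal.zero_eq_bot, Ideal.mem_bot]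
  · rw [hx]
    exact zero_mem _

end

/-- Affine form of Proposition 2.4 (p = 1): pull-backs of torsion Kähler
differentials are torsion.  The ℂ-algebra homomorphism `φ : B → A` is encoded
by the algebra structure `Algebra B A` together with the compatibility
`IsScalarTower ℂ B A`; the induced map `dφ` is `KaehlerDifferential.map ℂ ℂ B A`. -/
theorem pullback_of_torsion_differential_is_torsion
    (B A : Type*) [CommRing B] [CommRing A]
    [Algebra ℂ B] [Algebra ℂ A] [IsReduced B] [IsReduced A]
    [Algebra.FiniteType ℂ B] [Algebra.FiniteType ℂ A]
    [Algebra B A] [IsScalarTower ℂ B A]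
    (ω : Ω[B⁄ℂ]) (hω : ω ∈ Submodule.torsion B (Ω[B⁄ℂ])) :
    KaehlerDifferential.map ℂ ℂ B A ω ∈ Submodule.torsion A (Ω[A⁄ℂ]) := by
  have : IsNoetherianRing A := Algebra.FiniteType.isNoetherianRing ℂ A
  refine KaehlerDifferential.mem_torsion_of_map_residueField_eq_zero fun q ↦ ?_
  have hprime := RingHom.ker_isPrime (algebraMap B q.asIdeal.ResidueField)
  rw [KaehlerDifferential.map_map_apply ℂ B A,
    ← KaehlerDifferential.map_residueField_eq_zero_iff
      (RingHom.ker (algebraMap B q.asIdeal.ResidueField)) rfl]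
  exact KaehlerDifferential.map_residueField_eq_zero_of_mem_torsion hω ⟨_, hprime⟩
end

section
/- Let A = ℂ[X,Y,Z]/(Z³ + Y² − X²Z²), let B = A/(y,z) (where y, z are the images of Y, Z), and let π : A → B be the quotient map, so that B ≅ ℂ[x]. Then the composite of the inclusion of the torsion submodule tor Ω_{A/ℂ} ⊆ Ω_{A/ℂ} with the induced map dπ : Ω_{A/ℂ} → Ω_{B/ℂ} is zero; that is, every torsion Kähler differential on A restricts to zero on the singular locus {y = z = 0}. (The example of Figure 2.1, a special case of Proposition 2.4.) -/
/-- The coordinate ring `A = ℂ[X,Y,Z]/(Z³ + Y² − X²Z²)` of the surface of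
Figure 2.1, whose singular locus is the line `{y = z = 0}`. -/
abbrev Fig21Surface : Type :=
  MvPolynomial (Fin 3) ℂ ⧸
    Ideal.span {(MvPolynomial.X 2 ^ 3 + MvPolynomial.X 1 ^ 2
      - MvPolynomial.X 0 ^ 2 * MvPolynomial.X 2 ^ 2 : MvPolynomial (Fin 3) ℂ)}

/-- The coordinate ring `B = A/(y,z) ≅ ℂ[x]` of the singular locus. -/
abbrev Fig21SingularLocus : Type :=
  Fig21Surface ⧸
    Ideal.span {(Ideal.Quotient.mk _ (MvPolynomial.X 1) : Fig21Surface),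
                (Ideal.Quotient.mk _ (MvPolynomial.X 2) : Fig21Surface)}

namespace KaehlerDifferential

theorem map_map_apply_s11 {R A P B : Type*} [CommRing R] [CommRing A] [CommRing P] [CommRing B]
    [Algebra R A] [Algebra R P] [Algebra R B] [Algebra A P] [Algebra P B] [Algebra A B]
    [IsScalarTower R A P] [IsScalarTower R P B] [IsScalarTower R A B] [IsScalarTower A P B]
    (ω : Ω[A⁄R]) : map R R P B (map R R A P ω) = map R R A B ω := by
  have hω : ω ∈ Submodule.span A (Set.range (D R A)) := by
    rw [span_range_derivation]; trivial
  induction hω using Submodule.span_induction with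
  | mem x hx =>
    obtain ⟨a, rfl⟩ := hx
    simp only [map_D, ← IsScalarTower.algebraMap_apply]
  | zero => simp
  | add x y _ _ hx hy => simp only [map_add, hx, hy]
  | smul a x _ hx =>
    rw [LinearMap.map_smul, LinearMap.map_smul, ← hx, ← algebraMap_smul P a (map R R A P x), map_smul,
      algebraMap_smul]

/-- A torsion differential dies on every scheme whose map to `Spec A` factors through a dominant
map from an integral scheme with torsion-free differentials. -/
theorem map_eq_zero_of_mem_torsion {R A P B : Type*} [CommRing R] [CommRing A]
    [CommRing P] [CommRing B] [Algebra R A] [Algebra R P] [Algebra R B] [Algebra A B]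
    [IsScalarTower R A B] [IsDomain P] [Module.IsTorsionFree P Ω[P⁄R]]
    (φ : A →ₐ[R] P) (hφ : Function.Injective φ) (ψ : P →ₐ[R] B)
    (hψ : ∀ a, ψ (φ a) = algebraMap A B a)
    {ω : Ω[A⁄R]} (hω : ω ∈ Submodule.torsion A Ω[A⁄R]) : map R R A B ω = 0 := by
  let : Algebra A P := φ.toRingHom.toAlgebra
  let : Algebra P B := ψ.toRingHom.toAlgebra
  have : IsScalarTower R A P := .of_algHom φ
  have : IsScalarTower R P B := .of_algHom ψ
  have : IsScalarTower A P B := .of_algebraMap_eq fun a => (hψ a).symm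
  obtain ⟨a, ha⟩ := (Submodule.mem_torsion_iff _).mp hω
  have : Nontrivial A := (algebraMap A P).domain_nontrivial
  have ha0 : algebraMap A P a ≠ 0 :=
    (map_ne_zero_iff φ hφ).mpr (nonZeroDivisors.coe_ne_zero a)
  have h : algebraMap A P a • map R R A P ω = 0 := by
    rw [algebraMap_smul, ← map_smul]
    exact (congrArg _ ha).trans (map_zero _)
  rw [← map_map_apply_s11 (P := P), (smul_eq_zero.mp h).resolve_left ha0, map_zero]

end KaehlerDifferential

namespace Fig21Surface

open MvPolynomial

/-- The normalization `ℂ[x,w]` of the surface, with `y = w(x² - w²)` and `z = x² - w²`. -/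
noncomputable def normalization : Fig21Surface →ₐ[ℂ] MvPolynomial (Fin 2) ℂ :=
  Ideal.Quotient.liftₐ _
    (aeval ![X 0, X 1 * (X 0 ^ 2 - X 1 ^ 2), X 0 ^ 2 - X 1 ^ 2]) fun a ha => by
      obtain ⟨c, rfl⟩ := Ideal.mem_span_singleton.mp ha
      simp only [map_mul, map_sub, map_add, map_pow, aeval_X]
      simp
      left
      ring

/-- The coordinate functions of the surface. -/
noncomputable abbrev coord (i : Fin 3) : Fig21Surface := Ideal.Quotient.mk _ (X i)

theorem normalization_coord (i : Fin 3) : normalization (coord i) =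
    (![X 0, X 1 * (X 0 ^ 2 - X 1 ^ 2), X 0 ^ 2 - X 1 ^ 2] : Fin 3 → MvPolynomial (Fin 2) ℂ) i :=
  aeval_X _ i

theorem coord_relation : coord 1 ^ 2 = coord 0 ^ 2 * coord 2 ^ 2 - coord 2 ^ 3 := by
  have h := Ideal.Quotient.eq_zero_iff_mem.mpr (Ideal.mem_span_singleton_self
    (X 2 ^ 3 + X 1 ^ 2 - X 0 ^ 2 * X 2 ^ 2 : MvPolynomial (Fin 3) ℂ))
  simp only [map_sub, map_add, map_mul, map_pow] at h
  linear_combination h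

/-- The inclusion of `ℂ[x][z]` in the coordinate ring of the surface. -/
noncomputable def ofXZ : Polynomial (Polynomial ℂ) →+* Fig21Surface :=
  Polynomial.eval₂RingHom (Polynomial.aeval (R := ℂ) (coord 0)).toRingHom (coord 2)

theorem ofXZ_X : ofXZ Polynomial.X = coord 2 := by simp [ofXZ]

theorem ofXZ_C_X : ofXZ (Polynomial.C Polynomial.X) = coord 0 := by simp [ofXZ]

theorem ofXZ_C_C (c : ℂ) :
    ofXZ (Polynomial.C (Polynomial.C c)) = algebraMap ℂ Fig21Surface c := by simp [ofXZ]

theorem exists_eq_ofXZ_add (a : Fig21Surface) :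
    ∃ p q, a = ofXZ p + coord 1 * ofXZ q := by
  obtain ⟨f, rfl⟩ := Ideal.Quotient.mk_surjective a
  induction f using MvPolynomial.induction_on with
  | C c => exact ⟨.C (.C c), 0, by rw [ofXZ_C_C, map_zero, mul_zero, add_zero]; rfl⟩
  | add f g hf hg =>
    obtain ⟨p, q, h⟩ := hf
    obtain ⟨p', q', h'⟩ := hg
    exact ⟨p + p', q + q', by simp only [map_add, h, h']; ring⟩
  | mul_X f i h =>
    obtain ⟨p, q, h⟩ := h
    rw [map_mul, h]
    fin_cases i
    · refine ⟨p * .C .X, q * .C .X, ?_⟩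
      simp only [map_mul, ofXZ_C_X]
      change _ * coord 0 = _
      ring
    · refine ⟨q * (.C .X ^ 2 * .X ^ 2 - .X ^ 3), p, ?_⟩
      simp only [map_mul, map_sub, map_pow, ofXZ_C_X, ofXZ_X]
      change _ * coord 1 = _
      linear_combination ofXZ q * coord_relation
    · refine ⟨p * .X, q * .X, ?_⟩
      simp only [map_mul, ofXZ_X]
      change _ * coord 2 = _
      ring

/-- The identification of `ℂ[x,w]` with `ℂ[x][w]`, as a map. -/
noncomputable def iterated : MvPolynomial (Fin 2) ℂ →ₐ[ℂ] Polynomial (Polynomial ℂ) :=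
  aeval ![.C .X, .X]

theorem iterated_normalization_ofXZ (p : Polynomial (Polynomial ℂ)) :
    iterated (normalization (ofXZ p)) = p.comp (.C (.X ^ 2) - .X ^ 2) := by
  have h : (iterated.toRingHom.comp normalization.toRingHom).comp ofXZ =
      Polynomial.compRingHom (.C (.X ^ 2) - .X ^ 2) := by
    ext
    · simp [ofXZ_C_C, Polynomial.algebraMap_apply]
    · simp [ofXZ_C_X, normalization_coord, iterated]
    · simp [ofXZ_X, normalization_coord, iterated]
  exact congrArg (fun f => f p) h

theorem natDegree_quadric :
    (.C (.X ^ 2) - .X ^ 2 : Polynomial (Polynomial ℂ)).natDegree = 2 := by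
  compute_degree!

theorem eq_zero_of_comp_quadric {p : Polynomial (Polynomial ℂ)}
    (h : p.comp (.C (.X ^ 2) - .X ^ 2) = 0) : p = 0 := by
  rcases Polynomial.comp_eq_zero_iff.mp h with h | ⟨-, h⟩
  · exact h
  · have := congrArg Polynomial.natDegree h
    rw [natDegree_quadric, Polynomial.natDegree_C] at this
    omega

theorem normalization_injective : Function.Injective normalization := by
  rw [injective_iff_map_eq_zero]
  intro a ha
  obtain ⟨p, q, rfl⟩ := exists_eq_ofXZ_add a
  have h := congrArg iterated ha
  simp only [map_add, map_mul, iterated_normalization_ofXZ, map_zero] at h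
  have hy : iterated (normalization (coord 1)) = .X * (.C (.X ^ 2) - .X ^ 2) := by
    simp [normalization_coord, iterated]
  rw [hy] at h
  have h' := congrArg (fun f => Polynomial.comp f (-.X)) h
  simp only [Polynomial.add_comp, Polynomial.mul_comp, Polynomial.comp_assoc,
    Polynomial.sub_comp, Polynomial.C_comp, Polynomial.pow_comp, Polynomial.X_comp,
    Polynomial.zero_comp] at h'
  have hsq : (-.X) ^ 2 = (.X ^ 2 : Polynomial (Polynomial ℂ)) := by ring
  rw [hsq] at h'
  have hp : p = 0 := eq_zero_of_comp_quadric <| by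
    have : (2 : Polynomial (Polynomial ℂ)) * p.comp (.C (.X ^ 2) - .X ^ 2) = 0 := by
      linear_combination h + h'
    exact (mul_eq_zero.mp this).resolve_left two_ne_zero
  subst hp
  have hq : q = 0 := eq_zero_of_comp_quadric <| by
    rw [Polynomial.zero_comp, zero_add] at h
    refine (mul_eq_zero.mp h).resolve_left (mul_ne_zero Polynomial.X_ne_zero fun h0 => ?_)
    have := natDegree_quadric
    rw [h0, Polynomial.natDegree_zero] at this
    omega
  simp [hq]

/-- The restriction of functions to the singular locus. -/
noncomputable def restrict : Fig21Surface →ₐ[ℂ] Fig21SingularLocus :=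
  Ideal.Quotient.mkₐ ℂ _

theorem restrict_coord_one : restrict (coord 1) = 0 :=
  Ideal.Quotient.eq_zero_iff_mem.mpr (Ideal.subset_span (Set.mem_insert _ _))

theorem restrict_coord_two : restrict (coord 2) = 0 :=
  Ideal.Quotient.eq_zero_iff_mem.mpr (Ideal.subset_span (Set.mem_insert_of_mem _ rfl))

/-- The branch `w = x` of the preimage of the singular locus in the normalization. -/
noncomputable def branch : MvPolynomial (Fin 2) ℂ →ₐ[ℂ] Fig21SingularLocus :=
  aeval fun _ => restrict (coord 0)

theorem branch_X (i : Fin 2) : branch (X i) = restrict (coord 0) := aeval_X _ i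

theorem branch_comp_normalization : branch.comp normalization = restrict := by
  apply Ideal.Quotient.algHom_ext
  apply MvPolynomial.algHom_ext
  intro i
  change branch (normalization (coord i)) = restrict (coord i)
  rw [normalization_coord]
  fin_cases i
  · exact branch_X 0
  · change branch (X 1 * (X 0 ^ 2 - X 1 ^ 2)) = restrict (coord 1)
    rw [restrict_coord_one, map_mul, map_sub, map_pow, map_pow, branch_X, branch_X, sub_self]
    exact mul_zero (restrict (coord 0))
  · change branch (X 0 ^ 2 - X 1 ^ 2) = restrict (coord 2)
    rw [restrict_coord_two, map_sub, map_pow, map_pow, branch_X, branch_X, sub_self]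

end Fig21Surface


/-- The example of Figure 2.1 (a special case of Proposition 2.4): every
torsion Kähler differential on `A = ℂ[X,Y,Z]/(Z³ + Y² − X²Z²)` restricts to
zero on the singular locus `{y = z = 0}`, i.e. the composite of the inclusion
`tor Ω_{A/ℂ} ⊆ Ω_{A/ℂ}` with `dπ : Ω_{A/ℂ} → Ω_{B/ℂ}` is zero. -/
theorem torsion_differential_restricts_to_zero_on_singular_locus :
    ∀ ω ∈ Submodule.torsion Fig21Surface (Ω[Fig21Surface⁄ℂ]),
      KaehlerDifferential.map ℂ ℂ Fig21Surface Fig21SingularLocus ω = 0 := by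
  intro ω hω
  have : Module.Free (MvPolynomial (Fin 2) ℂ) Ω[MvPolynomial (Fin 2) ℂ⁄ℂ] :=
    .of_basis (KaehlerDifferential.mvPolynomialBasis ℂ (Fin 2))
  exact KaehlerDifferential.map_eq_zero_of_mem_torsion Fig21Surface.normalization
    Fig21Surface.normalization_injective Fig21Surface.branch
    (DFunLike.congr_fun Fig21Surface.branch_comp_normalization) hω
end
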